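/- Let $p$ be a prime, $a \ge 1$, and let $s, t$ be integers with $1 \le s < p^a$ and $0 \le t \le s$. Then $p$ divides $\sum_{m=t}^{p^a - 1} (m+1)\binom{p^a - 1 - t}{m - t}\binom{p^a - s + t + 1}{m + 1}$. -/

import Mathlib

theorem Nat.Prime.dvd_choose_pow_add {p a r k : ℕ} (hp : p.Prime) (hr : r < k) (hk : k < p ^ a) :
    p ∣ (p ^ a + r).choose k := by
  rw [Nat.add_choose_eq]
  refine Finset.dvd_sum fun ij hij => ?_
  have hsum := Finset.HasAntidiagonal.mem_antidiagonal.mp hij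
  by_cases hi : ij.1 = 0
  · rw [Nat.choose_eq_zero_of_lt (show r < ij.2 by omega), mul_zero]
    exact dvd_zero p
  · exact (hp.dvd_choose_pow hi (by omega)).mul_right _

theorem Nat.sum_Icc_choose_sub_mul_choose {t n : ℕ} (M : ℕ) (ht : t ≤ n) :
    ∑ m ∈ Finset.Icc t n, (n - t).choose (m - t) * M.choose m = (M + (n - t)).choose n := by
  rw [Nat.add_choose_eq, Finset.Nat.sum_antidiagonal_eq_sum_range_succ_mk]
  refine Finset.sum_subset_zero_on_sdiff (fun m hm => ?_) (fun m hm => ?_) (fun m hm => ?_)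
  · simp only [Finset.mem_Icc, Finset.mem_range] at hm ⊢
    omega
  · simp only [Finset.mem_sdiff, Finset.mem_Icc, Finset.mem_range] at hm
    rw [Nat.choose_eq_zero_of_lt (show n - t < n - m by omega), mul_zero]
  · have hm := Finset.mem_Icc.mp hm
    rw [mul_comm, Nat.choose_symm_of_eq_add (show n - t = (m - t) + (n - m) by omega)]

/-- For a prime `p`, `a ≥ 1`, and `1 ≤ s < p^a`, `0 ≤ t ≤ s`, `p` divides
`A_{s,t} = ∑_{m=t}^{p^a - 1} (m+1) * C(p^a - 1 - t, m - t) * C(p^a - s + t + 1, m + 1)`. -/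
theorem stmt12 (p a : ℕ) (hp : p.Prime) (ha : 1 ≤ a) (s t : ℕ)
    (hs1 : 1 ≤ s) (hs2 : s < p ^ a) (hts : t ≤ s) :
    p ∣ ∑ m ∈ Finset.Icc t (p ^ a - 1),
        (m + 1) * (p ^ a - 1 - t).choose (m - t) * (p ^ a - s + t + 1).choose (m + 1) := by
  have key : ∀ m ∈ Finset.Icc t (p ^ a - 1),
      (m + 1) * (p ^ a - 1 - t).choose (m - t) * (p ^ a - s + t + 1).choose (m + 1) =
        (p ^ a - s + t + 1) * ((p ^ a - 1 - t).choose (m - t) * (p ^ a - s + t).choose m) := by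
    intro m _
    linear_combination
      (p ^ a - 1 - t).choose (m - t) * (Nat.add_one_mul_choose_eq (p ^ a - s + t) m).symm
  rw [Finset.sum_congr rfl key, ← Finset.mul_sum,
    Nat.sum_Icc_choose_sub_mul_choose _ (by omega),
    show p ^ a - s + t + (p ^ a - 1 - t) = p ^ a + (p ^ a - 1 - s) by omega]
  exact (hp.dvd_choose_pow_add (by omega) (by omega)).mul_left _
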